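/- arXiv:2503.22258 — 2 statements merged into one kernel-verified Lean document; each statement's English description precedes it below -/
import Mathlib

section
/- Let H : ℝ^d → ℝ and t > 0 be such that prox_{tH}(x) is nonempty for every x ∈ ℝ^d. Define the nonconvexity of a function H as NC(H) = sup over x, y ∈ ℝ^d and λ ∈ [0,1] of H(λx+(1−λ)y) − λH(x) − (1−λ)H(y). Then for all x, y ∈ ℝ^d and λ ∈ [0,1], M_H^t(λx+(1−λ)y) − λM_H^t(x) − (1−λ)M_H^t(y) ≤ NC(H); in particular NC(M_H^t) ≤ NC(H). -/
noncomputable section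

variable {d : ℕ}

/-- Moreau envelope `M_H^t(x) = inf_y H(y) + ‖x-y‖²/(2t)` (with `M_H^0 := H`). -/
noncomputable def moreau (H : EuclideanSpace ℝ (Fin d) → ℝ) (t : ℝ)
    (x : EuclideanSpace ℝ (Fin d)) : ℝ :=
  if t = 0 then H x else ⨅ y : EuclideanSpace ℝ (Fin d), (H y + ‖x - y‖ ^ 2 / (2 * t))

/-- Proximal map `prox_{tH}(x)` as the set of minimizers of `y ↦ H(y) + ‖x-y‖²/(2t)`. -/
def proxSet (H : EuclideanSpace ℝ (Fin d) → ℝ) (t : ℝ)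
    (x : EuclideanSpace ℝ (Fin d)) : Set (EuclideanSpace ℝ (Fin d)) :=
  {p | ∀ y, H p + ‖x - p‖ ^ 2 / (2 * t) ≤ H y + ‖x - y‖ ^ 2 / (2 * t)}

/-- Nonconvexity `NC(H)`, valued in `EReal` since the supremum may be infinite. -/
noncomputable def NC (H : EuclideanSpace ℝ (Fin d) → ℝ) : EReal :=
  ⨆ (x : EuclideanSpace ℝ (Fin d)) (y : EuclideanSpace ℝ (Fin d)) (lam : ℝ)
    (_ : lam ∈ Set.Icc (0 : ℝ) 1),
    ((H (lam • x + (1 - lam) • y) - lam * H x - (1 - lam) * H y : ℝ) : EReal)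

/-- the Moreau envelope does not increase the nonconvexity. -/
theorem nonconvexity_moreau_le (H : EuclideanSpace ℝ (Fin d) → ℝ) (t : ℝ) (ht : 0 < t)
    (hprox : ∀ x, (proxSet H t x).Nonempty) :
    (∀ x y : EuclideanSpace ℝ (Fin d), ∀ lam ∈ Set.Icc (0 : ℝ) 1,
      ((moreau H t (lam • x + (1 - lam) • y) - lam * moreau H t x
        - (1 - lam) * moreau H t y : ℝ) : EReal) ≤ NC H) ∧
    NC (moreau H t) ≤ NC H := by
  have hM : ∀ x p, p ∈ proxSet H t x → moreau H t x = H p + ‖x - p‖ ^ 2 / (2 * t) := by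
    intro x p hp
    unfold moreau
    rw [if_neg ht.ne']
    apply le_antisymm
    · exact ciInf_le ⟨_, by rintro _ ⟨y, rfl⟩; exact hp y⟩ p
    · exact le_ciInf hp
  have key : ∀ x y : EuclideanSpace ℝ (Fin d), ∀ lam ∈ Set.Icc (0 : ℝ) 1,
      ((moreau H t (lam • x + (1 - lam) • y) - lam * moreau H t x
        - (1 - lam) * moreau H t y : ℝ) : EReal) ≤ NC H := by
    intro x y lam hl
    obtain ⟨p, hp⟩ := hprox x
    obtain ⟨q, hq⟩ := hprox y
    obtain ⟨r, hr⟩ := hprox (lam • x + (1 - lam) • y)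
    rw [hM x p hp, hM y q hq, hM _ r hr]
    have hr' := hr (lam • p + (1 - lam) • q)
    have hle : ((H (lam • p + (1 - lam) • q) - lam * H p - (1 - lam) * H q : ℝ) : EReal)
        ≤ NC H := by
      unfold NC
      exact le_iSup_of_le p (le_iSup_of_le q (le_iSup_of_le lam (le_iSup_of_le hl le_rfl)))
    refine le_trans (EReal.coe_le_coe_iff.2 ?_) hle
    have hv : lam • x + (1 - lam) • y - (lam • p + (1 - lam) • q)
        = lam • (x - p) + (1 - lam) • (y - q) := by module
    have h0 : (0 : ℝ) ≤ 1 - lam := by linarith [hl.2]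
    have hn : ‖lam • (x - p) + (1 - lam) • (y - q)‖ ≤ lam * ‖x - p‖ + (1 - lam) * ‖y - q‖ := by
      refine (norm_add_le _ _).trans_eq ?_
      rw [norm_smul, norm_smul, Real.norm_of_nonneg hl.1, Real.norm_of_nonneg h0]
    have hsq : ‖lam • (x - p) + (1 - lam) • (y - q)‖ ^ 2
        ≤ lam * ‖x - p‖ ^ 2 + (1 - lam) * ‖y - q‖ ^ 2 := by
      refine (pow_le_pow_left₀ (norm_nonneg _) hn 2).trans ?_
      nlinarith [mul_nonneg (mul_nonneg hl.1 h0) (sq_nonneg (‖x - p‖ - ‖y - q‖))]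
    have hdiv := div_le_div_of_nonneg_right hsq (by positivity : (0 : ℝ) ≤ 2 * t)
    rw [add_div, mul_div_assoc, mul_div_assoc] at hdiv
    rw [hv] at hr'
    linarith
  refine ⟨key, ?_⟩
  conv_lhs => unfold NC
  exact iSup_le fun x => iSup_le fun y => iSup_le fun lam => iSup_le fun hl => key x y lam hl
end
end

section
/- Let H : ℝ^d → ℝ be locally bounded, convex outside a ball B_M(0) for some M > 0, and satisfy ∫ exp(−H(x)) dx < ∞. Then H grows asymptotically at least linearly: there exist C > 0 and R > 0 such that H(x) ≥ C‖x‖ for all x with ‖x‖ ≥ R. -/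
noncomputable section

open MeasureTheory

variable {d : ℕ}

/-- `H` is locally bounded: bounded above on a neighborhood of every point. -/
def LocBdd (H : EuclideanSpace ℝ (Fin d) → ℝ) : Prop :=
  ∀ x : EuclideanSpace ℝ (Fin d), ∃ U ∈ nhds x, BddAbove (H '' U)

/-- `H` is convex outside the ball `B_M(0)`. -/
def ConvexOutside (H : EuclideanSpace ℝ (Fin d) → ℝ) (M : ℝ) : Prop :=
  ∀ x y : EuclideanSpace ℝ (Fin d), M ≤ ‖x‖ → M ≤ ‖y‖ →
    ∀ lam ∈ Set.Icc (0 : ℝ) 1,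
      H (lam • x + (1 - lam) • y) ≤ lam * H x + (1 - lam) * H y

/-- a locally bounded function that is convex outside a ball and has
integrable `exp(−H)` grows asymptotically at least linearly. -/
theorem linear_growth_of_integrable
    (H : EuclideanSpace ℝ (Fin d) → ℝ) (hloc : LocBdd H)
    (M : ℝ) (hM : 0 < M) (hconv : ConvexOutside H M)
    (hint : Integrable (fun x : EuclideanSpace ℝ (Fin d) => Real.exp (-H x))) :
    ∃ C > 0, ∃ R > 0, ∀ x : EuclideanSpace ℝ (Fin d), R ≤ ‖x‖ → C * ‖x‖ ≤ H x := by
  classical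
  -- upper bound on a compact ball
  obtain ⟨K, hK0, hK⟩ : ∃ K : ℝ, 0 ≤ K ∧ ∀ q : EuclideanSpace ℝ (Fin d), ‖q‖ ≤ M + 2 → H q ≤ K := by
    have hc : IsCompact (Metric.closedBall (0 : EuclideanSpace ℝ (Fin d)) (M + 2)) :=
      isCompact_closedBall _ _
    have hb : BddAbove (H '' Metric.closedBall (0 : EuclideanSpace ℝ (Fin d)) (M + 2)) := by
      refine hc.induction_on (p := fun s => BddAbove (H '' s)) (by simp) ?_ ?_ ?_
      · intro s t hst ht
        exact ht.mono (Set.image_mono hst)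
      · intro s t hs ht
        rw [Set.image_union]
        exact hs.union ht
      · intro x _
        obtain ⟨U, hU, hb⟩ := hloc x
        exact ⟨U, mem_nhdsWithin_of_mem_nhds hU, hb⟩
    obtain ⟨K, hK⟩ := hb
    refine ⟨max K 0, le_max_right _ _, fun q hq => le_trans (hK ⟨q, ?_, rfl⟩) (le_max_left _ _)⟩
    simpa using hq
  -- tails of the integral are small
  have htail := tendsto_setIntegral_of_antitone (μ := volume)
    (f := fun x : EuclideanSpace ℝ (Fin d) => Real.exp (-H x))
    (s := fun n : ℕ => (Metric.ball (0 : EuclideanSpace ℝ (Fin d)) n)ᶜ)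
    (fun n => Metric.isOpen_ball.measurableSet.compl)
    (fun m n hmn => Set.compl_subset_compl.2 (Metric.ball_subset_ball (by exact_mod_cast hmn)))
    ⟨0, hint.integrableOn⟩
  have hempty : (⋂ n : ℕ, (Metric.ball (0 : EuclideanSpace ℝ (Fin d)) n)ᶜ) = ∅ := by
    rw [← Set.compl_iUnion, Metric.iUnion_ball_nat, Set.compl_univ]
  rw [hempty, setIntegral_empty] at htail
  set v : ℝ := volume.real (Metric.ball (0 : EuclideanSpace ℝ (Fin d)) (1 / 2)) with hv
  have hvpos : 0 < v :=
    ENNReal.toReal_pos (Metric.measure_ball_pos volume _ (by norm_num)).ne' measure_ball_lt_top.ne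
  have hε : 0 < Real.exp (-(K + 1)) * v := by positivity
  obtain ⟨n, hn⟩ := (htail.eventually (gt_mem_nhds hε)).exists
  set T : ℝ := n + 1 with hT
  have hTpos : 0 < T := by positivity
  refine ⟨1 / T, by positivity, 2 * T + M, by positivity, fun x hx => ?_⟩
  by_contra! hlt
  have hxpos : 0 < ‖x‖ := by linarith
  set t : ℝ := T / ‖x‖ with ht
  have htx : t * ‖x‖ = T := by rw [ht]; field_simp
  have ht0 : 0 < t := by positivity
  have ht2 : t ≤ 1 / 2 := by rw [ht, div_le_iff₀ hxpos]; linarith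
  set a : ℝ := (M + 1) / ‖x‖ with ha
  have hax : a * ‖x‖ = M + 1 := by rw [ha]; field_simp
  have ha0 : 0 < a := by positivity
  set c : EuclideanSpace ℝ (Fin d) := ((1 - t) * a + t) • x with hc
  have hcn : T ≤ ‖c‖ := by
    have h1 : 0 ≤ (1 - t) * a := mul_nonneg (by linarith) ha0.le
    rw [hc, norm_smul, Real.norm_of_nonneg (by linarith)]
    nlinarith
  have hball : ∀ z ∈ Metric.ball c (1 / 2), H z ≤ K + 1 := by
    intro z hz
    rw [mem_ball_iff_norm] at hz
    have h1t : 0 < 1 - t := by linarith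
    set w : EuclideanSpace ℝ (Fin d) := (1 - t)⁻¹ • (z - c) with hw
    have hwn : ‖w‖ ≤ 1 := by
      rw [hw, norm_smul, Real.norm_of_nonneg (by positivity), inv_mul_le_iff₀ h1t]
      linarith
    have hp : ‖a • x‖ = M + 1 := by
      rw [norm_smul, Real.norm_of_nonneg ha0.le, hax]
    have hq1 : M ≤ ‖a • x + w‖ := by
      have := norm_sub_le (a • x + w) w
      rw [add_sub_cancel_right] at this
      linarith
    have hq2 : ‖a • x + w‖ ≤ M + 2 := by
      have := norm_add_le (a • x) w
      linarith
    have hzc : t • x + (1 - t) • (a • x + w) = z := by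
      rw [smul_add, hw, smul_inv_smul₀ h1t.ne', hc]
      module
    have h := hconv x (a • x + w) (by linarith) hq1 t ⟨ht0.le, by linarith⟩
    rw [hzc] at h
    have h3 : t * H x ≤ 1 := by
      have : t * (1 / T * ‖x‖) = 1 := by
        rw [mul_left_comm, htx]; field_simp
      nlinarith
    have h4 : (1 - t) * H (a • x + w) ≤ K := by
      have := mul_le_mul_of_nonneg_left (hK _ hq2) h1t.le
      nlinarith
    linarith
  have hsub : Metric.ball c (1 / 2) ⊆ (Metric.ball (0 : EuclideanSpace ℝ (Fin d)) n)ᶜ := by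
    intro z hz
    rw [mem_ball_iff_norm] at hz
    simp only [Set.mem_compl_iff, mem_ball_zero_iff, not_lt]
    have := norm_sub_norm_le c z
    rw [norm_sub_rev] at this
    linarith
  have hle : ∫ x in Metric.ball c (1 / 2), Real.exp (-H x) ≤
      ∫ x in (Metric.ball (0 : EuclideanSpace ℝ (Fin d)) n)ᶜ, Real.exp (-H x) :=
    setIntegral_mono_set hint.integrableOn
      (Filter.Eventually.of_forall fun x => (Real.exp_pos _).le) hsub.eventuallyLE
  have hge : Real.exp (-(K + 1)) * v ≤ ∫ x in Metric.ball c (1 / 2), Real.exp (-H x) := by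
    have h := setIntegral_mono_on (μ := volume) (s := Metric.ball c (1 / 2))
      (f := fun _ => Real.exp (-(K + 1))) (g := fun x => Real.exp (-H x))
      (integrableOn_const measure_ball_lt_top.ne) hint.integrableOn
      Metric.isOpen_ball.measurableSet
      (fun z hz => Real.exp_le_exp.2 (neg_le_neg (hball z hz)))
    rw [setIntegral_const, smul_eq_mul, mul_comm, measureReal_def, Measure.addHaar_ball_center] at h
    exact h
  linarith
end
end
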